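/- Let n ∈ ℝ³ be a unit vector, let P := I − n⊗n, let ε be a symmetric real 3×3 matrix with ε·n = 0, let μ ≥ 0 and λ₀ ≥ 0 and γ ≥ 0 be real numbers, and let κ be a real 3×3 matrix with Frobenius norm ‖κ‖ ≤ K. Define σ := 2μ·ε + λ₀·(tr ε)·P. Then σ : ε − γ·(σ : κ)² ≥ (1 − 2γ·K²·(μ + λ₀))·(σ : ε). In particular, if γ < 1/(2K²(μ + λ₀)) with μ + λ₀ > 0 and K > 0, the right-hand side coefficient 1 − 2γK²(μ + λ₀) is positive. -/

import Mathlib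

open Matrix

/-- The Frobenius (double-dot) product `A : B := Σ_{i,j} A_{ij}·B_{ij}`. -/
def frob (A B : Matrix (Fin 3) (Fin 3) ℝ) : ℝ := ∑ i, ∑ j, A i j * B i j

theorem frob_cs (A B : Matrix (Fin 3) (Fin 3) ℝ) :
    (frob A B) ^ 2 ≤ frob A A * frob B B := by
  have h := Finset.sum_mul_sq_le_sq_mul_sq (Finset.univ : Finset (Fin 3 × Fin 3))
    (fun p => A p.1 p.2) (fun p => B p.1 p.2)
  simp only [Fintype.sum_prod_type, pow_two (A _ _), pow_two (B _ _)] at h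
  exact h

theorem frob_self_nonneg (A : Matrix (Fin 3) (Fin 3) ℝ) : 0 ≤ frob A A :=
  Finset.sum_nonneg fun _ _ => Finset.sum_nonneg fun _ _ => mul_self_nonneg _

/-- For a unit vector `n`, `P := I − n⊗n`, a symmetric `3×3` matrix `ε`
with `ε·n = 0`, reals `μ ≥ 0`, `λ₀ ≥ 0`, `γ ≥ 0`, and a `3×3` matrix `κ` with Frobenius
norm `‖κ‖ ≤ K`, the stress `σ := 2μ·ε + λ₀·(tr ε)·P` satisfies
`σ : ε − γ·(σ : κ)² ≥ (1 − 2γ·K²·(μ + λ₀))·(σ : ε)`.  Moreover, if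
`γ < 1/(2K²(μ + λ₀))` with `μ + λ₀ > 0` and `K > 0`, the coefficient
`1 − 2γK²(μ + λ₀)` is positive. -/
theorem coercivity_with_curvature (n : Fin 3 → ℝ) (hn : n ⬝ᵥ n = 1)
    (ε : Matrix (Fin 3) (Fin 3) ℝ) (hε : ε.IsSymm) (hεn : ε.mulVec n = 0)
    (μ lam₀ γ K : ℝ) (hμ : 0 ≤ μ) (hlam : 0 ≤ lam₀) (hγ : 0 ≤ γ)
    (κ : Matrix (Fin 3) (Fin 3) ℝ) (hκ : Real.sqrt (frob κ κ) ≤ K)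
    (P : Matrix (Fin 3) (Fin 3) ℝ) (hP : P = 1 - vecMulVec n n)
    (σ : Matrix (Fin 3) (Fin 3) ℝ)
    (hσ : σ = (2 * μ) • ε + (lam₀ * ε.trace) • P) :
    frob σ ε - γ * (frob σ κ) ^ 2 ≥ (1 - 2 * γ * K ^ 2 * (μ + lam₀)) * frob σ ε ∧
      (0 < μ + lam₀ → 0 < K → γ < 1 / (2 * K ^ 2 * (μ + lam₀)) →
        0 < 1 - 2 * γ * K ^ 2 * (μ + lam₀)) := by
  have hPP : frob P P = 2 := by
    subst hP
    simp [dotProduct, Fin.sum_univ_three] at hn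
    simp [frob, Fin.sum_univ_three, vecMulVec_apply, Matrix.one_apply]
    linear_combination (n 0 * n 0 + n 1 * n 1 + n 2 * n 2 - 1) * hn
  have hPe : frob P ε = ε.trace := by
    have h0 := congrFun hεn 0
    have h1 := congrFun hεn 1
    have h2 := congrFun hεn 2
    subst hP
    simp [mulVec, dotProduct, Fin.sum_univ_three] at h0 h1 h2
    simp [frob, Fin.sum_univ_three, vecMulVec_apply, Matrix.one_apply, Matrix.trace]
    linear_combination -n 0 * h0 - n 1 * h1 - n 2 * h2
  have hse : frob σ ε = 2 * μ * frob ε ε + lam₀ * ε.trace * frob P ε := by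
    subst hσ
    simp only [frob, Fin.sum_univ_three, Matrix.add_apply, Matrix.smul_apply, smul_eq_mul]
    ring
  have hss : frob σ σ = (2 * μ) ^ 2 * frob ε ε + 2 * (2 * μ) * (lam₀ * ε.trace) * frob P ε
      + (lam₀ * ε.trace) ^ 2 * frob P P := by
    subst hσ
    simp only [frob, Fin.sum_univ_three, Matrix.add_apply, Matrix.smul_apply, smul_eq_mul]
    ring
  have ht := frob_cs P ε
  rw [hPP, hPe] at ht
  rw [hPe] at hse hss
  rw [hPP] at hss
  have hK : frob κ κ ≤ K ^ 2 := (Real.sqrt_le_left (le_trans (Real.sqrt_nonneg _) hκ)).1 hκ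
  have h1 : frob σ σ ≤ 2 * (μ + lam₀) * frob σ ε := by
    rw [hss, hse]
    have := mul_nonneg (mul_nonneg hμ hlam) (sub_nonneg.2 ht)
    nlinarith
  have h2 : (frob σ κ) ^ 2 ≤ 2 * (μ + lam₀) * frob σ ε * K ^ 2 :=
    (frob_cs σ κ).trans (mul_le_mul h1 hK (frob_self_nonneg κ)
      ((frob_self_nonneg σ).trans h1))
  refine ⟨?_, fun hm hk hg => ?_⟩
  · have := mul_le_mul_of_nonneg_left h2 hγ
    nlinarith
  · rw [lt_div_iff₀ (by positivity)] at hg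
    linarith
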